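/- arXiv:2201.00394 — 7 statements merged into one kernel-verified Lean document; each statement's English description precedes it below -/
import Mathlib

section
/- For a finite undirected graph G = (V,E), the optimal objective value of the RR^tot integer programming formulation equals the signed total Roman domination number of G. That is, the minimum of ∑_{i∈V} (2x_i + y_i − 1) over all binary vectors x, y : V → {0,1} satisfying (a) x_i ≥ y_i for all i ∈ V, (b) x_i + ∑_{j∈N(i)} y_j ≥ 1 for all i ∈ V, and (c) ∑_{j∈N(i)} (2x_j + y_j − 1) ≥ 1 for all i ∈ V, is equal to the minimum of ∑_{i∈V} f(i) over all signed total Roman dominating functions f on G. -/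
theorem rr_tot_eq_signed_total_roman_domination_number
    {V : Type*} [Fintype V] [DecidableEq V] (G : SimpleGraph V) [DecidableRel G.Adj] :
    sInf {w : ℤ | ∃ x y : V → ℤ,
        (∀ i, x i = 0 ∨ x i = 1) ∧ (∀ i, y i = 0 ∨ y i = 1) ∧
        (∀ i, y i ≤ x i) ∧
        (∀ i, 1 ≤ x i + ∑ j ∈ G.neighborFinset i, y j) ∧
        (∀ i, 1 ≤ ∑ j ∈ G.neighborFinset i, (2 * x j + y j - 1)) ∧
        w = ∑ i, (2 * x i + y i - 1)} =
    sInf {w : ℤ | ∃ f : V → ℤ,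
        (∀ i, f i = -1 ∨ f i = 1 ∨ f i = 2) ∧
        (∀ i, 1 ≤ ∑ j ∈ G.neighborFinset i, f j) ∧
        (∀ i, f i = -1 → ∃ j ∈ G.neighborFinset i, f j = 2) ∧
        w = ∑ i, f i} := by
  congr 1
  ext w
  constructor
  · rintro ⟨x, y, hx, hy, hyx, hdom, hsum, hw⟩
    refine ⟨fun i => 2 * x i + y i - 1, fun i => ?_, hsum, fun i hi => ?_, hw⟩
    · have := hx i
      have := hy i
      have := hyx i
      dsimp only
      omega
    · have hxi : x i = 0 := by
        have := hx i
        have := hy i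
        dsimp only at hi
        omega
      have hpos : 0 < ∑ j ∈ G.neighborFinset i, y j := by
        have := hdom i
        omega
      obtain ⟨j, hj, hyj⟩ := Finset.exists_lt_of_sum_lt
        (f := fun _ => (0 : ℤ)) (by simpa using hpos)
      refine ⟨j, hj, ?_⟩
      have := hx j
      have := hy j
      have := hyx j
      dsimp only
      omega
  · rintro ⟨f, hf, hsum, hdom, hw⟩
    have hval : ∀ i, 2 * (if f i = -1 then (0 : ℤ) else 1) + (if f i = 2 then 1 else 0) - 1
        = f i := by
      intro i
      rcases hf i with h | h | h <;> simp [h]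
    have hy : ∀ j, (0 : ℤ) ≤ if f j = 2 then 1 else 0 := by
      intro j
      split_ifs <;> simp
    refine ⟨fun i => if f i = -1 then 0 else 1, fun i => if f i = 2 then 1 else 0,
      fun i => ?_, fun i => ?_, fun i => ?_, fun i => ?_, ?_, ?_⟩
    · dsimp only
      split_ifs <;> simp
    · dsimp only
      split_ifs <;> simp
    · rcases hf i with h | h | h <;> simp [h]
    · by_cases h : f i = -1
      · obtain ⟨j, hj, hfj⟩ := hdom i h
        have hle := Finset.single_le_sum
          (f := fun j => if f j = 2 then (1 : ℤ) else 0) (fun k _ => hy k) hj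
        simp only [hfj, if_true] at hle
        simpa only [h, if_true, zero_add] using hle
      · have hnonneg := Finset.sum_nonneg (s := G.neighborFinset i) (fun j _ => hy j)
        simp only [h, if_false]
        linarith
    · simpa only [hval] using hsum
    · simpa only [hval] using hw
end

section
/- For a finite undirected graph G = (V,E), the optimal objective value of the RR integer programming formulation equals the signed Roman domination number of G. That is, the minimum of ∑_{i∈V} (2x_i + y_i − 1) over all binary vectors x, y : V → {0,1} satisfying (a) x_i ≥ y_i for all i ∈ V, (b) x_i + ∑_{j∈N(i)} y_j ≥ 1 for all i ∈ V, and (c) ∑_{j∈N[i]} (2x_j + y_j − 1) ≥ 1 for all i ∈ V, is equal to the minimum of ∑_{i∈V} f(i) over all signed Roman dominating functions f on G. -/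
theorem rr_eq_signed_roman_domination_number
    {V : Type*} [Fintype V] [DecidableEq V] (G : SimpleGraph V) [DecidableRel G.Adj] :
    sInf {w : ℤ | ∃ x y : V → ℤ,
        (∀ i, x i = 0 ∨ x i = 1) ∧ (∀ i, y i = 0 ∨ y i = 1) ∧
        (∀ i, y i ≤ x i) ∧
        (∀ i, 1 ≤ x i + ∑ j ∈ G.neighborFinset i, y j) ∧
        (∀ i, 1 ≤ ∑ j ∈ insert i (G.neighborFinset i), (2 * x j + y j - 1)) ∧
        w = ∑ i, (2 * x i + y i - 1)} =
    sInf {w : ℤ | ∃ f : V → ℤ,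
        (∀ i, f i = -1 ∨ f i = 1 ∨ f i = 2) ∧
        (∀ i, 1 ≤ ∑ j ∈ insert i (G.neighborFinset i), f j) ∧
        (∀ i, f i = -1 → ∃ j ∈ G.neighborFinset i, f j = 2) ∧
        w = ∑ i, f i} := by
  congr 1
  ext w
  constructor
  · rintro ⟨x, y, hx, hy, hyx, hdom, hsum, rfl⟩
    refine ⟨fun i => 2 * x i + y i - 1, fun i => ?_, hsum, fun i hi => ?_, rfl⟩
    · have := hx i
      have := hy i
      have := hyx i
      dsimp only
      omega
    · have hxi : x i = 0 := by
        have := hx i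
        have := hy i
        dsimp only at hi
        omega
      have hne : ∑ j ∈ G.neighborFinset i, y j ≠ 0 := by
        have := hdom i
        omega
      obtain ⟨j, hj, hyj⟩ := Finset.exists_ne_zero_of_sum_ne_zero hne
      refine ⟨j, hj, ?_⟩
      have := hx j
      have := hy j
      have := hyx j
      dsimp only
      omega
  · rintro ⟨f, hf, hsum, hdom, rfl⟩
    have hy (i : V) : 0 ≤ if f i = 2 then (1 : ℤ) else 0 := by split_ifs <;> simp
    have hfxy (i : V) :
        2 * (if f i = -1 then (0 : ℤ) else 1) + (if f i = 2 then 1 else 0) - 1 = f i := by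
      have := hf i
      split_ifs <;> omega
    refine ⟨fun i => if f i = -1 then 0 else 1, fun i => if f i = 2 then 1 else 0,
      fun i => ?_, fun i => ?_, fun i => ?_, fun i => ?_, fun i => ?_, ?_⟩
    · dsimp only
      split_ifs <;> simp
    · dsimp only
      split_ifs <;> simp
    · dsimp only
      split_ifs <;> omega
    · by_cases hi : f i = -1
      · obtain ⟨j, hj, hfj⟩ := hdom i hi
        have := Finset.single_le_sum (f := fun j => if f j = 2 then (1 : ℤ) else 0)
          (fun k _ => hy k) hj
        simpa only [hi, hfj, if_true, zero_add] using this
      · have := Finset.sum_nonneg (s := G.neighborFinset i) fun k _ => hy k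
        simpa only [hi, if_false, le_add_iff_nonneg_right] using this
    · simpa only [hfxy] using hsum i
    · simp only [hfxy]
end

section
/- For a finite undirected graph G = (V,E), the optimal objective value of the BVV^tot integer programming formulation equals the signed total Roman domination number of G. That is, the minimum of ∑_{i∈V} (2x_i + 3y_i − 1) over all binary vectors x, y : V → {0,1} satisfying (a) x_i + y_i ≤ 1 for all i ∈ V, (b) x_i + y_i + ∑_{j∈N(i)} y_j ≥ 1 for all i ∈ V, and (c) ∑_{j∈N(i)} (2x_j + 3y_j − 1) ≥ 1 for all i ∈ V, is equal to the minimum of ∑_{i∈V} f(i) over all signed total Roman dominating functions f on G. -/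
theorem bvv_tot_eq_signed_total_roman_domination_number
    {V : Type*} [Fintype V] [DecidableEq V] (G : SimpleGraph V) [DecidableRel G.Adj] :
    sInf {w : ℤ | ∃ x y : V → ℤ,
        (∀ i, x i = 0 ∨ x i = 1) ∧ (∀ i, y i = 0 ∨ y i = 1) ∧
        (∀ i, x i + y i ≤ 1) ∧
        (∀ i, 1 ≤ x i + y i + ∑ j ∈ G.neighborFinset i, y j) ∧
        (∀ i, 1 ≤ ∑ j ∈ G.neighborFinset i, (2 * x j + 3 * y j - 1)) ∧
        w = ∑ i, (2 * x i + 3 * y i - 1)} =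
    sInf {w : ℤ | ∃ f : V → ℤ,
        (∀ i, f i = -1 ∨ f i = 1 ∨ f i = 2) ∧
        (∀ i, 1 ≤ ∑ j ∈ G.neighborFinset i, f j) ∧
        (∀ i, f i = -1 → ∃ j ∈ G.neighborFinset i, f j = 2) ∧
        w = ∑ i, f i} := by
  congr 1
  ext w
  constructor
  · rintro ⟨x, y, hx, hy, hxy, hdom, hsum, rfl⟩
    refine ⟨fun i => 2 * x i + 3 * y i - 1, fun i => ?_, hsum, fun i hi => ?_, rfl⟩
    · have := hx i
      have := hy i
      have := hxy i
      dsimp only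
      omega
    · have hpos : ∑ j ∈ G.neighborFinset i, y j ≠ 0 := by
        have := hx i
        have := hy i
        have := hdom i
        dsimp only at hi
        omega
      obtain ⟨j, hj, hyj⟩ := Finset.exists_ne_zero_of_sum_ne_zero hpos
      refine ⟨j, hj, ?_⟩
      have := hx j
      have := hy j
      have := hxy j
      dsimp only
      omega
  · rintro ⟨f, hf, hsum, hdef, rfl⟩
    have hdecode : ∀ i,
        2 * (if f i = 1 then (1 : ℤ) else 0) + 3 * (if f i = 2 then (1 : ℤ) else 0) - 1 = f i := by
      intro i
      have := hf i
      split_ifs <;> omega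
    refine ⟨fun i => if f i = 1 then 1 else 0, fun i => if f i = 2 then 1 else 0,
      fun i => ?_, fun i => ?_, fun i => ?_, fun i => ?_, fun i => ?_, ?_⟩
    · dsimp only
      split_ifs <;> simp
    · dsimp only
      split_ifs <;> simp
    · dsimp only
      split_ifs <;> omega
    · dsimp only
      have hnonneg : ∀ j ∈ G.neighborFinset i, (0 : ℤ) ≤ if f j = 2 then 1 else 0 := by
        intro j _
        split_ifs <;> simp
      have hsum_nonneg := Finset.sum_nonneg hnonneg
      rcases hf i with hi | hi | hi
      · obtain ⟨j, hj, hfj⟩ := hdef i hi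
        have hle := Finset.single_le_sum hnonneg hj
        rw [if_pos hfj] at hle
        split_ifs <;> omega
      · rw [if_pos hi]
        split_ifs <;> omega
      · rw [if_pos hi]
        split_ifs <;> omega
    · simpa only [hdecode] using hsum i
    · simp only [hdecode]
end

section
/- For a finite undirected graph G = (V,E), the optimal objective value of the BVV integer programming formulation equals the signed Roman domination number of G. That is, the minimum of ∑_{i∈V} (2x_i + 3y_i − 1) over all binary vectors x, y : V → {0,1} satisfying (a) x_i + y_i ≤ 1 for all i ∈ V, (b) x_i + y_i + ∑_{j∈N(i)} y_j ≥ 1 for all i ∈ V, and (c) ∑_{j∈N[i]} (2x_j + 3y_j − 1) ≥ 1 for all i ∈ V, is equal to the minimum of ∑_{i∈V} f(i) over all signed Roman dominating functions f on G. -/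
theorem bvv_eq_signed_roman_domination_number
    {V : Type*} [Fintype V] [DecidableEq V] (G : SimpleGraph V) [DecidableRel G.Adj] :
    sInf {w : ℤ | ∃ x y : V → ℤ,
        (∀ i, x i = 0 ∨ x i = 1) ∧ (∀ i, y i = 0 ∨ y i = 1) ∧
        (∀ i, x i + y i ≤ 1) ∧
        (∀ i, 1 ≤ x i + y i + ∑ j ∈ G.neighborFinset i, y j) ∧
        (∀ i, 1 ≤ ∑ j ∈ insert i (G.neighborFinset i), (2 * x j + 3 * y j - 1)) ∧
        w = ∑ i, (2 * x i + 3 * y i - 1)} =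
    sInf {w : ℤ | ∃ f : V → ℤ,
        (∀ i, f i = -1 ∨ f i = 1 ∨ f i = 2) ∧
        (∀ i, 1 ≤ ∑ j ∈ insert i (G.neighborFinset i), f j) ∧
        (∀ i, f i = -1 → ∃ j ∈ G.neighborFinset i, f j = 2) ∧
        w = ∑ i, f i} := by
  congr 1
  ext w
  constructor
  · rintro ⟨x, y, hx, hy, hxy, hdom, hsum, hw⟩
    refine ⟨fun i => 2 * x i + 3 * y i - 1, fun i => ?_, hsum, fun i hi => ?_, hw⟩
    · have := hx i
      have := hy i
      have := hxy i
      dsimp only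
      omega
    · by_contra! hne
      have hzero : ∑ j ∈ G.neighborFinset i, y j = 0 := by
        refine Finset.sum_eq_zero fun j hj => ?_
        have := hne j hj
        have := hx j
        have := hy j
        have := hxy j
        omega
      have := hdom i
      have := hx i
      have := hy i
      dsimp only at hi
      omega
  · rintro ⟨f, hf, hsum, hdef, hw⟩
    have hval : ∀ i, 2 * (if f i = 1 then 1 else 0) + 3 * (if f i = 2 then 1 else 0) - 1 = f i := by
      intro i
      rcases hf i with h | h | h <;> simp [h]
    refine ⟨fun i => if f i = 1 then 1 else 0, fun i => if f i = 2 then 1 else 0,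
      fun i => ?_, fun i => ?_, fun i => ?_, fun i => ?_, fun i => ?_, ?_⟩
    · dsimp only
      split_ifs <;> simp
    · dsimp only
      split_ifs <;> simp
    · rcases hf i with h | h | h <;> simp [h]
    · have hnonneg : ∀ j ∈ G.neighborFinset i, (0 : ℤ) ≤ if f j = 2 then 1 else 0 := by
        intro j _
        split_ifs <;> simp
      dsimp only
      have hsum_nonneg := Finset.sum_nonneg hnonneg
      rcases hf i with h | h | h
      · obtain ⟨j, hj, hj2⟩ := hdef i h
        have hle := Finset.single_le_sum hnonneg hj
        rw [if_pos hj2] at hle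
        simp only [h]
        norm_num at hle ⊢
        exact hle
      · have hne : f i ≠ 2 := by omega
        rw [if_pos h, if_neg hne]
        linarith
      · have hne : f i ≠ 1 := by omega
        rw [if_neg hne, if_pos h]
        linarith
    · simpa only [hval] using hsum i
    · simpa only [hval] using hw
end

section
/- (Theorem 5.) Let G = (V,E) be a finite undirected graph. The affine substitution (x', y') ↦ (x' + y', y') is a bijection from the polyhedron of the LP relaxation of BVV^tot onto the polyhedron of the LP relaxation of RR^tot; that is, the image of { (x',y') : V → ℝ × ℝ feasible for relaxed BVV^tot } under this map equals { (x'',y'') feasible for relaxed RR^tot }, with inverse (x'', y'') ↦ (x'' − y'', y''). Moreover the objective values agree: ∑_{i∈V} (2x'_i + 3y'_i − 1) = ∑_{i∈V} (2(x'_i + y'_i) + y'_i − 1). -/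
theorem polyhedra_bvv_tot_rr_tot_equivalent
    {V : Type*} [Fintype V] [DecidableEq V] (G : SimpleGraph V) [DecidableRel G.Adj] :
    (fun p : (V → ℝ) × (V → ℝ) => (p.1 + p.2, p.2)) ''
      {p : (V → ℝ) × (V → ℝ) |
        (∀ i, 0 ≤ p.1 i ∧ p.1 i ≤ 1) ∧ (∀ i, 0 ≤ p.2 i ∧ p.2 i ≤ 1) ∧
        (∀ i, p.1 i + p.2 i ≤ 1) ∧
        (∀ i, 1 ≤ p.1 i + p.2 i + ∑ j ∈ G.neighborFinset i, p.2 j) ∧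
        (∀ i, 1 ≤ ∑ j ∈ G.neighborFinset i, (2 * p.1 j + 3 * p.2 j - 1))} =
      {q : (V → ℝ) × (V → ℝ) |
        (∀ i, 0 ≤ q.1 i ∧ q.1 i ≤ 1) ∧ (∀ i, 0 ≤ q.2 i ∧ q.2 i ≤ 1) ∧
        (∀ i, q.2 i ≤ q.1 i) ∧
        (∀ i, 1 ≤ q.1 i + ∑ j ∈ G.neighborFinset i, q.2 j) ∧
        (∀ i, 1 ≤ ∑ j ∈ G.neighborFinset i, (2 * q.1 j + q.2 j - 1))} ∧
    (∀ p ∈ {p : (V → ℝ) × (V → ℝ) |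
        (∀ i, 0 ≤ p.1 i ∧ p.1 i ≤ 1) ∧ (∀ i, 0 ≤ p.2 i ∧ p.2 i ≤ 1) ∧
        (∀ i, p.1 i + p.2 i ≤ 1) ∧
        (∀ i, 1 ≤ p.1 i + p.2 i + ∑ j ∈ G.neighborFinset i, p.2 j) ∧
        (∀ i, 1 ≤ ∑ j ∈ G.neighborFinset i, (2 * p.1 j + 3 * p.2 j - 1))},
      (fun q : (V → ℝ) × (V → ℝ) => (q.1 - q.2, q.2))
        ((fun p : (V → ℝ) × (V → ℝ) => (p.1 + p.2, p.2)) p) = p) ∧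
    (∀ q ∈ {q : (V → ℝ) × (V → ℝ) |
        (∀ i, 0 ≤ q.1 i ∧ q.1 i ≤ 1) ∧ (∀ i, 0 ≤ q.2 i ∧ q.2 i ≤ 1) ∧
        (∀ i, q.2 i ≤ q.1 i) ∧
        (∀ i, 1 ≤ q.1 i + ∑ j ∈ G.neighborFinset i, q.2 j) ∧
        (∀ i, 1 ≤ ∑ j ∈ G.neighborFinset i, (2 * q.1 j + q.2 j - 1))},
      (fun p : (V → ℝ) × (V → ℝ) => (p.1 + p.2, p.2))
        ((fun q : (V → ℝ) × (V → ℝ) => (q.1 - q.2, q.2)) q) = q) ∧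
    (∀ p ∈ {p : (V → ℝ) × (V → ℝ) |
        (∀ i, 0 ≤ p.1 i ∧ p.1 i ≤ 1) ∧ (∀ i, 0 ≤ p.2 i ∧ p.2 i ≤ 1) ∧
        (∀ i, p.1 i + p.2 i ≤ 1) ∧
        (∀ i, 1 ≤ p.1 i + p.2 i + ∑ j ∈ G.neighborFinset i, p.2 j) ∧
        (∀ i, 1 ≤ ∑ j ∈ G.neighborFinset i, (2 * p.1 j + 3 * p.2 j - 1))},
      ∑ i, (2 * p.1 i + 3 * p.2 i - 1) =
        ∑ i, (2 * (p.1 i + p.2 i) + p.2 i - 1)) := by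
  refine ⟨?_, fun p _ => Prod.ext (add_sub_cancel_right _ _) rfl,
    fun q _ => Prod.ext (sub_add_cancel _ _) rfl,
    fun p _ => Finset.sum_congr rfl fun i _ => by ring⟩
  have weight_eq (a b : ℝ) : 2 * (a + b) + b - 1 = 2 * a + 3 * b - 1 := by ring
  have weight_eq' (a b : ℝ) : 2 * (a - b) + 3 * b - 1 = 2 * a + b - 1 := by ring
  ext q
  constructor
  · rintro ⟨p, ⟨hx, hy, hxy, hdom, htot⟩, rfl⟩
    refine ⟨fun i => ⟨add_nonneg (hx i).1 (hy i).1, hxy i⟩, hy,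
      fun i => le_add_of_nonneg_left (hx i).1, hdom, ?_⟩
    simpa only [Pi.add_apply, weight_eq] using htot
  · rintro ⟨hx, hy, hyx, hdom, htot⟩
    refine ⟨(q.1 - q.2, q.2), ⟨fun i => ⟨sub_nonneg.2 (hyx i), ?_⟩, hy, ?_, ?_, ?_⟩,
      Prod.ext (sub_add_cancel _ _) rfl⟩
    · exact (sub_le_self _ (hy i).1).trans (hx i).2
    · simpa only [Pi.sub_apply, sub_add_cancel] using fun i => (hx i).2
    · simpa only [Pi.sub_apply, sub_add_cancel] using hdom
    · simpa only [Pi.sub_apply, weight_eq'] using htot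
end

section
/- (Theorem 6.) Let G = (V,E) be a finite undirected graph. The affine substitution (x', y') ↦ (x' + y', y') is a bijection from the polyhedron of the LP relaxation of BVV onto the polyhedron of the LP relaxation of RR; that is, the image of { (x',y') : V → ℝ × ℝ feasible for relaxed BVV } under this map equals { (x'',y'') feasible for relaxed RR }, with inverse (x'', y'') ↦ (x'' − y'', y''). Moreover the objective values agree: ∑_{i∈V} (2x'_i + 3y'_i − 1) = ∑_{i∈V} (2(x'_i + y'_i) + y'_i − 1). -/
theorem polyhedra_bvv_rr_equivalent
    {V : Type*} [Fintype V] [DecidableEq V] (G : SimpleGraph V) [DecidableRel G.Adj] :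
    (fun p : (V → ℝ) × (V → ℝ) => (p.1 + p.2, p.2)) ''
      {p : (V → ℝ) × (V → ℝ) |
        (∀ i, 0 ≤ p.1 i ∧ p.1 i ≤ 1) ∧ (∀ i, 0 ≤ p.2 i ∧ p.2 i ≤ 1) ∧
        (∀ i, p.1 i + p.2 i ≤ 1) ∧
        (∀ i, 1 ≤ p.1 i + p.2 i + ∑ j ∈ G.neighborFinset i, p.2 j) ∧
        (∀ i, 1 ≤ ∑ j ∈ insert i (G.neighborFinset i), (2 * p.1 j + 3 * p.2 j - 1))} =
      {q : (V → ℝ) × (V → ℝ) |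
        (∀ i, 0 ≤ q.1 i ∧ q.1 i ≤ 1) ∧ (∀ i, 0 ≤ q.2 i ∧ q.2 i ≤ 1) ∧
        (∀ i, q.2 i ≤ q.1 i) ∧
        (∀ i, 1 ≤ q.1 i + ∑ j ∈ G.neighborFinset i, q.2 j) ∧
        (∀ i, 1 ≤ ∑ j ∈ insert i (G.neighborFinset i), (2 * q.1 j + q.2 j - 1))} ∧
    (∀ p ∈ {p : (V → ℝ) × (V → ℝ) |
        (∀ i, 0 ≤ p.1 i ∧ p.1 i ≤ 1) ∧ (∀ i, 0 ≤ p.2 i ∧ p.2 i ≤ 1) ∧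
        (∀ i, p.1 i + p.2 i ≤ 1) ∧
        (∀ i, 1 ≤ p.1 i + p.2 i + ∑ j ∈ G.neighborFinset i, p.2 j) ∧
        (∀ i, 1 ≤ ∑ j ∈ insert i (G.neighborFinset i), (2 * p.1 j + 3 * p.2 j - 1))},
      (fun q : (V → ℝ) × (V → ℝ) => (q.1 - q.2, q.2))
        ((fun p : (V → ℝ) × (V → ℝ) => (p.1 + p.2, p.2)) p) = p) ∧
    (∀ q ∈ {q : (V → ℝ) × (V → ℝ) |
        (∀ i, 0 ≤ q.1 i ∧ q.1 i ≤ 1) ∧ (∀ i, 0 ≤ q.2 i ∧ q.2 i ≤ 1) ∧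
        (∀ i, q.2 i ≤ q.1 i) ∧
        (∀ i, 1 ≤ q.1 i + ∑ j ∈ G.neighborFinset i, q.2 j) ∧
        (∀ i, 1 ≤ ∑ j ∈ insert i (G.neighborFinset i), (2 * q.1 j + q.2 j - 1))},
      (fun p : (V → ℝ) × (V → ℝ) => (p.1 + p.2, p.2))
        ((fun q : (V → ℝ) × (V → ℝ) => (q.1 - q.2, q.2)) q) = q) ∧
    (∀ p ∈ {p : (V → ℝ) × (V → ℝ) |
        (∀ i, 0 ≤ p.1 i ∧ p.1 i ≤ 1) ∧ (∀ i, 0 ≤ p.2 i ∧ p.2 i ≤ 1) ∧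
        (∀ i, p.1 i + p.2 i ≤ 1) ∧
        (∀ i, 1 ≤ p.1 i + p.2 i + ∑ j ∈ G.neighborFinset i, p.2 j) ∧
        (∀ i, 1 ≤ ∑ j ∈ insert i (G.neighborFinset i), (2 * p.1 j + 3 * p.2 j - 1))},
      ∑ i, (2 * p.1 i + 3 * p.2 i - 1) =
        ∑ i, (2 * (p.1 i + p.2 i) + p.2 i - 1)) := by
  have objective_eq : ∀ a b : ℝ, 2 * (a + b) + b - 1 = 2 * a + 3 * b - 1 := fun a b => by ring
  refine ⟨?_, fun p _ => by simp, fun q _ => by simp,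
    fun p _ => Finset.sum_congr rfl fun i _ => (objective_eq _ _).symm⟩
  ext ⟨x, y⟩
  constructor
  · rintro ⟨⟨a, b⟩, ⟨ha, hb, hab, hdom, hsum⟩, h⟩
    obtain ⟨rfl, rfl⟩ := Prod.mk.inj h
    refine ⟨fun i => ⟨add_nonneg (ha i).1 (hb i).1, hab i⟩, hb,
      fun i => le_add_of_nonneg_left (ha i).1, hdom, fun i => ?_⟩
    simpa only [Pi.add_apply, objective_eq] using hsum i
  · rintro ⟨hx, hy, hyx, hdom, hsum⟩
    refine ⟨(x - y, y), ⟨fun i => ⟨sub_nonneg.2 (hyx i), ?_⟩, hy, fun i => ?_, fun i => ?_,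
      fun i => ?_⟩, by simp⟩
    · exact (sub_le_self _ (hy i).1).trans (hx i).2
    · simpa using (hx i).2
    · simpa using hdom i
    · simpa only [← objective_eq, Pi.sub_apply, sub_add_cancel] using hsum i
end

section
/- Let G = (V,E) be a finite undirected graph and let x, y : V → {0,1} be a feasible solution of the RR^tot formulation, i.e. x_i ≥ y_i, x_i + ∑_{j∈N(i)} y_j ≥ 1, and ∑_{j∈N(i)} (2x_j + y_j − 1) ≥ 1 for all i ∈ V. Then the function f : V → ℤ defined by f(i) = 2x_i + y_i − 1 is a signed total Roman dominating function on G, and its weight satisfies ∑_{i∈V} f(i) = ∑_{i∈V} (2x_i + y_i − 1). -/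
theorem rr_tot_feasible_gives_strdf
    {V : Type*} [Fintype V] [DecidableEq V] (G : SimpleGraph V) [DecidableRel G.Adj]
    (x y : V → ℤ)
    (hx : ∀ i, x i = 0 ∨ x i = 1) (hy : ∀ i, y i = 0 ∨ y i = 1)
    (h1 : ∀ i, y i ≤ x i)
    (h2 : ∀ i, 1 ≤ x i + ∑ j ∈ G.neighborFinset i, y j)
    (h3 : ∀ i, 1 ≤ ∑ j ∈ G.neighborFinset i, (2 * x j + y j - 1))
    (f : V → ℤ) (hf : ∀ i, f i = 2 * x i + y i - 1) :
    (∀ i, f i = -1 ∨ f i = 1 ∨ f i = 2) ∧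
    (∀ i, 1 ≤ ∑ j ∈ G.neighborFinset i, f j) ∧
    (∀ i, f i = -1 → ∃ j ∈ G.neighborFinset i, f j = 2) ∧
    ∑ i, f i = ∑ i, (2 * x i + y i - 1) := by
  refine ⟨fun i => ?_, fun i => ?_, fun i hi => ?_, Finset.sum_congr rfl fun i _ => hf i⟩
  · grind
  · simpa only [hf] using h3 i
  · have hsum : 0 < ∑ j ∈ G.neighborFinset i, y j := by grind
    obtain ⟨j, hj, hyj⟩ := Finset.exists_lt_of_sum_lt
      (show ∑ _j ∈ G.neighborFinset i, (0 : ℤ) < ∑ j ∈ G.neighborFinset i, y j by simpa using hsum)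
    exact ⟨j, hj, by grind⟩
end
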